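/- arXiv:1003.0979 — 6 statements merged into one kernel-verified Lean document; each statement's English description precedes it below -/
import Mathlib

section
/- Let A be a C^∞ field of endomorphisms of ℝ^d. For every q ∈ ℕ with q ≥ 1, all C^∞ vector fields X, Y and every x ∈ ℝ^d, one has N'_{A,A^q}(X,Y)(x) = Σ_{k=1}^{q} A(x)^{q−k}( N_A(X, A^{k−1}Y)(x) ), where A^{k−1}Y is the vector field x ↦ A(x)^{k−1}(Y(x)). -/
open scoped BigOperators

noncomputable section

/-- The Lie bracket of two vector fields on `ℝ^d`:
`[X,Y](x) = (fderiv Y x)(X x) - (fderiv X x)(Y x)`. -/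
def lieVF {d : ℕ} (X Y : (Fin d → ℝ) → (Fin d → ℝ)) : (Fin d → ℝ) → (Fin d → ℝ) :=
  fun x => fderiv ℝ Y x (X x) - fderiv ℝ X x (Y x)

/-- The Nijenhuis torsion tensor of a field of endomorphisms `A` of `ℝ^d`:
`N_A(X,Y) = [AX,AY] - A[X,AY] - A[AX,Y] + A²[X,Y]`. -/
def nijT {d : ℕ} (A : (Fin d → ℝ) → ((Fin d → ℝ) →L[ℝ] (Fin d → ℝ)))
    (X Y : (Fin d → ℝ) → (Fin d → ℝ)) : (Fin d → ℝ) → (Fin d → ℝ) :=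
  fun x =>
    lieVF (fun y => A y (X y)) (fun y => A y (Y y)) x
      - A x (lieVF X (fun y => A y (Y y)) x)
      - A x (lieVF (fun y => A y (X y)) Y x)
      + A x (A x (lieVF X Y x))

/-- The tensor `N'_{A,B}(X,Y) = [AX,BY] - A[X,BY] - B[AX,Y] + AB[X,Y]` for two
(pointwise commuting) fields of endomorphisms `A, B` of `ℝ^d`. -/
def nijT' {d : ℕ} (A B : (Fin d → ℝ) → ((Fin d → ℝ) →L[ℝ] (Fin d → ℝ)))
    (X Y : (Fin d → ℝ) → (Fin d → ℝ)) : (Fin d → ℝ) → (Fin d → ℝ) :=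
  fun x =>
    lieVF (fun y => A y (X y)) (fun y => B y (Y y)) x
      - A x (lieVF X (fun y => B y (Y y)) x)
      - B x (lieVF (fun y => A y (X y)) Y x)
      + A x (B x (lieVF X Y x))

/-- Replacing `A ^ n` by `A ^ (n + 1)` in `N'_{A,A^n}` amounts to applying `A` and adding
`N_A(X, A^n Y)`. -/
lemma nijT'_pow_succ {d : ℕ} (A : (Fin d → ℝ) → ((Fin d → ℝ) →L[ℝ] (Fin d → ℝ))) (n : ℕ)
    (X Y : (Fin d → ℝ) → (Fin d → ℝ)) (x : Fin d → ℝ) :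
    nijT' A (fun y => A y ^ (n + 1)) X Y x =
      A x (nijT' A (fun y => A y ^ n) X Y x) + nijT A X (fun y => (A y ^ n) (Y y)) x := by
  simp only [nijT', nijT, pow_succ', mul_apply_eq_comp, map_add, map_sub]
  abel

lemma nijT'_pow_zero {d : ℕ} (A : (Fin d → ℝ) → ((Fin d → ℝ) →L[ℝ] (Fin d → ℝ)))
    (X Y : (Fin d → ℝ) → (Fin d → ℝ)) (x : Fin d → ℝ) :
    nijT' A (fun y => A y ^ 0) X Y x = 0 := by
  simp [nijT']

/-- Proposition 2.2(i): `N'_{A,A^q}(X,Y) = ∑_{k=1}^q A^{q-k} N_A(X, A^{k-1}Y)`. -/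
theorem nijT'_pow_right (d : ℕ)
    (A : (Fin d → ℝ) → ((Fin d → ℝ) →L[ℝ] (Fin d → ℝ))) (hA : ContDiff ℝ (⊤ : ℕ∞) A)
    (q : ℕ) (hq : 1 ≤ q)
    (X Y : (Fin d → ℝ) → (Fin d → ℝ)) (hX : ContDiff ℝ (⊤ : ℕ∞) X) (hY : ContDiff ℝ (⊤ : ℕ∞) Y)
    (x : Fin d → ℝ) :
    nijT' A (fun y => A y ^ q) X Y x =
      ∑ k ∈ Finset.Icc 1 q,
        (A x ^ (q - k)) (nijT A X (fun y => (A y ^ (k - 1)) (Y y)) x) := by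
  clear hq
  induction q with
  | zero => simpa using nijT'_pow_zero A X Y x
  | succ n ih =>
    rw [nijT'_pow_succ, ih, Finset.sum_Icc_succ_top (Nat.le_add_left 1 n), map_sum]
    congr 1
    · refine Finset.sum_congr rfl fun k hk => ?_
      rw [Nat.succ_sub (Finset.mem_Icc.mp hk).2, pow_succ', mul_apply_eq_comp]
    · simp
end
end

section
/- Let A be a C^∞ field of endomorphisms of ℝ^d whose Nijenhuis tensor vanishes identically: N_A(X,Y)(x) = 0 for all C^∞ vector fields X, Y and all x. Then for all p, q ∈ ℕ with p ≥ 1 and q ≥ 1, one has N'_{A^p,A^q}(X,Y)(x) = 0 for all C^∞ vector fields X, Y and all x; in particular the Nijenhuis tensor of each field A^p : x ↦ A(x)^p vanishes identically. -/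
open scoped BigOperators

noncomputable section

theorem nijT'_comp_left {d : ℕ} (A B C : (Fin d → ℝ) → ((Fin d → ℝ) →L[ℝ] (Fin d → ℝ)))
    (X Y : (Fin d → ℝ) → (Fin d → ℝ)) (x : Fin d → ℝ) (hBC : Commute (B x) (C x)) :
    nijT' (fun y => A y * B y) C X Y x =
      nijT' A C (fun y => B y (X y)) Y x + A x (nijT' B C X Y x) := by
  have h (v : Fin d → ℝ) : B x (C x v) = C x (B x v) := congr($hBC.eq v)
  simp only [nijT', mul_apply_eq_comp, map_add, map_sub, h]
  abel

theorem nijT'_comp_right {d : ℕ} (A B C : (Fin d → ℝ) → ((Fin d → ℝ) →L[ℝ] (Fin d → ℝ)))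
    (X Y : (Fin d → ℝ) → (Fin d → ℝ)) (x : Fin d → ℝ) (hAB : Commute (A x) (B x)) :
    nijT' A (fun y => B y * C y) X Y x =
      nijT' A B X (fun y => C y (Y y)) x + B x (nijT' A C X Y x) := by
  have h (v : Fin d → ℝ) : A x (B x v) = B x (A x v) := congr($hAB.eq v)
  simp only [nijT', mul_apply_eq_comp, map_add, map_sub, h]
  abel

theorem nijT'_pow_right_eq_zero {d : ℕ}
    {A B : (Fin d → ℝ) → ((Fin d → ℝ) →L[ℝ] (Fin d → ℝ))} (hB : ContDiff ℝ (⊤ : ℕ∞) B)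
    (hAB : ∀ x, Commute (A x) (B x))
    (h : ∀ X Y : (Fin d → ℝ) → (Fin d → ℝ), ContDiff ℝ (⊤ : ℕ∞) X → ContDiff ℝ (⊤ : ℕ∞) Y →
      ∀ x, nijT' A B X Y x = 0)
    (q : ℕ) {X Y : (Fin d → ℝ) → (Fin d → ℝ)} (hX : ContDiff ℝ (⊤ : ℕ∞) X)
    (hY : ContDiff ℝ (⊤ : ℕ∞) Y) (x : Fin d → ℝ) :
    nijT' A (fun y => B y ^ q) X Y x = 0 := by
  induction q generalizing Y with
  | zero => simp [nijT']
  | succ q ih =>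
    simp only [pow_succ]
    rw [nijT'_comp_right _ _ _ _ _ _ ((hAB x).pow_right q), ih (hB.clm_apply hY), h X Y hX hY]
    simp

theorem nijT'_pow_left_eq_zero {d : ℕ}
    {A B : (Fin d → ℝ) → ((Fin d → ℝ) →L[ℝ] (Fin d → ℝ))} (hA : ContDiff ℝ (⊤ : ℕ∞) A)
    (hAB : ∀ x, Commute (A x) (B x))
    (h : ∀ X Y : (Fin d → ℝ) → (Fin d → ℝ), ContDiff ℝ (⊤ : ℕ∞) X → ContDiff ℝ (⊤ : ℕ∞) Y →
      ∀ x, nijT' A B X Y x = 0)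
    (p : ℕ) {X Y : (Fin d → ℝ) → (Fin d → ℝ)} (hX : ContDiff ℝ (⊤ : ℕ∞) X)
    (hY : ContDiff ℝ (⊤ : ℕ∞) Y) (x : Fin d → ℝ) :
    nijT' (fun y => A y ^ p) B X Y x = 0 := by
  induction p generalizing X with
  | zero => simp [nijT']
  | succ p ih =>
    simp only [pow_succ]
    rw [nijT'_comp_left _ _ _ _ _ _ (hAB x), ih (hA.clm_apply hX), h X Y hX hY]
    simp

/-- Concluding claim of Proposition 2.2: if `N_A = 0` then all `N'_{A^p,A^q}` vanish,
and in particular the Nijenhuis tensor of each `A^p` vanishes. -/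
theorem nijT'_pow_eq_zero_of_nijT_eq_zero (d : ℕ)
    (A : (Fin d → ℝ) → ((Fin d → ℝ) →L[ℝ] (Fin d → ℝ))) (hA : ContDiff ℝ (⊤ : ℕ∞) A)
    (hnij : ∀ X Y : (Fin d → ℝ) → (Fin d → ℝ), ContDiff ℝ (⊤ : ℕ∞) X → ContDiff ℝ (⊤ : ℕ∞) Y →
      ∀ x, nijT A X Y x = 0) :
    ∀ p q : ℕ, 1 ≤ p → 1 ≤ q →
      ∀ X Y : (Fin d → ℝ) → (Fin d → ℝ), ContDiff ℝ (⊤ : ℕ∞) X → ContDiff ℝ (⊤ : ℕ∞) Y →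
        ∀ x, nijT' (fun y => A y ^ p) (fun y => A y ^ q) X Y x = 0 ∧
          nijT (fun y => A y ^ p) X Y x = 0 := by
  have key (p q : ℕ) (X Y : (Fin d → ℝ) → (Fin d → ℝ)) (hX : ContDiff ℝ (⊤ : ℕ∞) X)
      (hY : ContDiff ℝ (⊤ : ℕ∞) Y) (x : Fin d → ℝ) :
      nijT' (fun y => A y ^ p) (fun y => A y ^ q) X Y x = 0 :=
    nijT'_pow_left_eq_zero hA (fun x => Commute.self_pow (A x) q)
      (fun _ _ hX hY => nijT'_pow_right_eq_zero hA (fun x => Commute.refl (A x)) hnij q hX hY)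
      p hX hY x
  exact fun p q _ _ X Y hX hY x => ⟨key p q X Y hX hY x, key p p X Y hX hY x⟩
end
end

section
/- Let A be a C^∞ field of endomorphisms of ℝ^d whose Nijenhuis tensor vanishes identically, let p ≥ 1, and let X, Y be C^∞ vector fields with A(x)^p(X(x)) = 0 and A(x)^p(Y(x)) = 0 for all x. Then A(x)^{2p}([X,Y](x)) = 0 for all x. -/
open scoped BigOperators

noncomputable section

/-- If a doubly indexed family satisfies the recursion
`B (i+1) (j+1) - f (B i (j+1)) - f (B (i+1) j) + f (f (B i j)) = 0` and vanishes as soon as one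
index is at least `p`, then `f ^ n` kills `B i j` whenever `2 * p ≤ n + i + j`. -/
theorem pow_apply_eq_zero_of_nijenhuis_recursion {R M : Type*} [Ring R] [AddCommGroup M]
    [TopologicalSpace M] [Module R M] (f : M →L[R] M) (B : ℕ → ℕ → M) (p : ℕ)
    (hB : ∀ i j, B (i + 1) (j + 1) - f (B i (j + 1)) - f (B (i + 1) j) + f (f (B i j)) = 0)
    (hl : ∀ i j, p ≤ i → B i j = 0) (hr : ∀ i j, p ≤ j → B i j = 0) (n : ℕ) :
    ∀ i j, 2 * p ≤ n + i + j → (f ^ n) (B i j) = 0 := by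
  induction n using Nat.strong_induction_on with
  | _ n ih =>
    intro i j h
    rcases le_or_gt p i with hi | hi
    · rw [hl i j hi, map_zero]
    rcases le_or_gt p j with hj | hj
    · rw [hr i j hj, map_zero]
    obtain ⟨m, rfl⟩ : ∃ m, n = m + 2 := ⟨n - 2, by omega⟩
    have h₁ := ih (m + 1) (by omega) i (j + 1) (by omega)
    have h₂ := ih (m + 1) (by omega) (i + 1) j (by omega)
    have h₃ := ih m (by omega) (i + 1) (j + 1) (by omega)
    have h₄ := congrArg (f ^ m) (hB i j)
    rw [pow_succ, mul_apply_eq_comp] at h₁ h₂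
    rw [pow_succ, pow_succ, mul_apply_eq_comp, mul_apply_eq_comp]
    simpa only [map_add, map_sub, map_zero, h₁, h₂, h₃, sub_zero, zero_add] using h₄

theorem lieVF_zero_left {d : ℕ} (Y : (Fin d → ℝ) → (Fin d → ℝ)) (x : Fin d → ℝ) :
    lieVF (fun _ => 0) Y x = 0 := by
  simp [lieVF]

theorem lieVF_zero_right {d : ℕ} (X : (Fin d → ℝ) → (Fin d → ℝ)) (x : Fin d → ℝ) :
    lieVF X (fun _ => 0) x = 0 := by
  simp [lieVF]

theorem ContinuousLinearMap.pow_apply_eq_zero_of_le {R M : Type*} [Semiring R] [AddCommMonoid M]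
    [TopologicalSpace M] [Module R M] (f : M →L[R] M) {p i : ℕ} (hpi : p ≤ i) {v : M}
    (hv : (f ^ p) v = 0) : (f ^ i) v = 0 := by
  rw [← Nat.sub_add_cancel hpi, pow_add, mul_apply_eq_comp, hv, map_zero]

/-- Remark 3.10: if `N_A = 0` and `X, Y ∈ ker A^p`, then `[X,Y] ∈ ker A^{2p}`. -/
theorem bracket_ker_mem_ker_sq (d : ℕ)
    (A : (Fin d → ℝ) → ((Fin d → ℝ) →L[ℝ] (Fin d → ℝ))) (hA : ContDiff ℝ (⊤ : ℕ∞) A)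
    (hnij : ∀ X Y : (Fin d → ℝ) → (Fin d → ℝ), ContDiff ℝ (⊤ : ℕ∞) X → ContDiff ℝ (⊤ : ℕ∞) Y →
      ∀ x, nijT A X Y x = 0)
    (p : ℕ) (hp : 1 ≤ p)
    (X Y : (Fin d → ℝ) → (Fin d → ℝ)) (hX : ContDiff ℝ (⊤ : ℕ∞) X) (hY : ContDiff ℝ (⊤ : ℕ∞) Y)
    (hXker : ∀ x, (A x ^ p) (X x) = 0) (hYker : ∀ x, (A x ^ p) (Y x) = 0) :
    ∀ x, (A x ^ (2 * p)) (lieVF X Y x) = 0 := by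
  intro x
  have hsmooth : ∀ Z : (Fin d → ℝ) → (Fin d → ℝ), ContDiff ℝ (⊤ : ℕ∞) Z → ∀ i : ℕ,
      ContDiff ℝ (⊤ : ℕ∞) (fun y => (A y ^ i) (Z y)) :=
    fun Z hZ i => (hA.pow i).clm_apply hZ
  have key := pow_apply_eq_zero_of_nijenhuis_recursion (A x)
    (fun i j => lieVF (fun y => (A y ^ i) (X y)) (fun y => (A y ^ j) (Y y)) x) p
    (fun i j => by
      simpa only [nijT, pow_succ', mul_apply_eq_comp] using
        hnij _ _ (hsmooth X hX i) (hsmooth Y hY j) x)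
    (fun i j hi => by
      simp only [(A _).pow_apply_eq_zero_of_le hi (hXker _), lieVF_zero_left])
    (fun i j hj => by
      simp only [(A _).pow_apply_eq_zero_of_le hj (hYker _), lieVF_zero_right])
    (2 * p) 0 0 (by omega)
  simpa using key
end
end

section
/- Let A be a C^∞ field of endomorphisms of ℝ^d whose Nijenhuis tensor vanishes identically. Then for every polynomial P ∈ ℝ[X], the Nijenhuis tensor of the field P(A) : x ↦ P(A(x)) (evaluation of P at the endomorphism A(x)) vanishes identically: N_{P(A)}(X,Y)(x) = 0 for all C^∞ vector fields X, Y and all x. -/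
open scoped BigOperators

noncomputable section

theorem commute_aeval_right {R S : Type*} [CommSemiring R] [Semiring S] [Algebra R S] {a b : S}
    (h : Commute a b) (P : Polynomial R) : Commute a (Polynomial.aeval b P) := by
  rw [Polynomial.aeval_eq_sum_range]
  exact Commute.sum_right _ _ _ fun i _ => (h.pow_right i).smul_right _

section Torsion

variable {E : Type*} [NormedAddCommGroup E] [NormedSpace ℝ E]

/-- The value at `x` of the tensor `N'_{A,B}` on a pair of vectors, written without extending the
vectors to vector fields. -/
def torsionAt (A B : E → (E →L[ℝ] E)) (x u v : E) : E :=
  fderiv ℝ B x (A x u) v - fderiv ℝ A x (B x v) u - A x (fderiv ℝ B x u v) + B x (fderiv ℝ A x v u)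

theorem torsionAt_swap (A B : E → (E →L[ℝ] E)) (x u v : E) :
    torsionAt B A x v u = -torsionAt A B x u v := by
  simp only [torsionAt]
  abel

theorem torsionAt_algebraMap_right (A : E → (E →L[ℝ] E)) (c : ℝ) (x u v : E) :
    torsionAt A (fun _ => algebraMap ℝ (E →L[ℝ] E) c) x u v = 0 := by
  simp [torsionAt, Algebra.algebraMap_eq_smul_one]

theorem torsionAt_add_right (A : E → (E →L[ℝ] E)) {B C : E → (E →L[ℝ] E)} {x : E}
    (hB : DifferentiableAt ℝ B x) (hC : DifferentiableAt ℝ C x) (u v : E) :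
    torsionAt A (fun y => B y + C y) x u v = torsionAt A B x u v + torsionAt A C x u v := by
  simp only [torsionAt, fderiv_fun_add hB hC, add_apply, map_add]
  abel

theorem torsionAt_mul_right {A B C : E → (E →L[ℝ] E)} {x : E} (hAB : Commute (A x) (B x))
    (hB : DifferentiableAt ℝ B x) (hC : DifferentiableAt ℝ C x) (u v : E) :
    torsionAt A (fun y => B y * C y) x u v =
      torsionAt A B x u (C x v) + B x (torsionAt A C x u v) := by
  have hcomm (w : E) : A x (B x w) = B x (A x w) := DFunLike.congr_fun hAB.eq w
  simp only [torsionAt, fderiv_fun_mul' hB hC, add_apply,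
    smul_apply, smul_eq_mul, MulOpposite.smul_eq_mul_unop,
    MulOpposite.unop_op, mul_apply_eq_comp, map_add, map_sub, hcomm]
  abel

theorem differentiable_aeval {A : E → (E →L[ℝ] E)} (hA : Differentiable ℝ A)
    (P : Polynomial ℝ) : Differentiable ℝ fun y => Polynomial.aeval (A y) P := by
  simp only [Polynomial.aeval_eq_sum_range]
  fun_prop

theorem torsionAt_aeval_right {A B : E → (E →L[ℝ] E)} {x : E} (hAB : Commute (A x) (B x))
    (hB : Differentiable ℝ B) (h : ∀ u v, torsionAt A B x u v = 0)
    (P : Polynomial ℝ) (u v : E) :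
    torsionAt A (fun y => Polynomial.aeval (B y) P) x u v = 0 := by
  induction P using Polynomial.induction_on generalizing u v with
  | C c => simpa using torsionAt_algebraMap_right A c x u v
  | add P Q hP hQ =>
    simp only [map_add]
    rw [torsionAt_add_right A (differentiable_aeval hB P x) (differentiable_aeval hB Q x),
      hP, hQ, add_zero]
  | monomial n c ih =>
    simp only [pow_succ, ← mul_assoc]
    simp only [map_mul _ (_ * _) Polynomial.X, Polynomial.aeval_X]
    rw [torsionAt_mul_right (commute_aeval_right hAB _) (differentiable_aeval hB _ x) (hB x), ih, h, map_zero, add_zero]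

theorem torsionAt_aeval_aeval {A : E → (E →L[ℝ] E)} (hA : Differentiable ℝ A) {x : E}
    (h : ∀ u v, torsionAt A A x u v = 0) (P Q : Polynomial ℝ) (u v : E) :
    torsionAt (fun y => Polynomial.aeval (A y) P) (fun y => Polynomial.aeval (A y) Q) x u v = 0 := by
  refine torsionAt_aeval_right ?_ hA (fun u v => ?_) Q u v
  · exact (commute_aeval_right (Commute.refl (A x)) P).symm
  · rw [torsionAt_swap, torsionAt_aeval_right (Commute.refl _) hA h, neg_zero]

end Torsion

theorem nijT_eq_torsionAt {d : ℕ} {A : (Fin d → ℝ) → ((Fin d → ℝ) →L[ℝ] (Fin d → ℝ))}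
    {X Y : (Fin d → ℝ) → (Fin d → ℝ)} {x : Fin d → ℝ} (hA : DifferentiableAt ℝ A x)
    (hX : DifferentiableAt ℝ X x) (hY : DifferentiableAt ℝ Y x) :
    nijT A X Y x = torsionAt A A x (X x) (Y x) := by
  simp only [nijT, lieVF, torsionAt, fderiv_clm_apply hA hX, fderiv_clm_apply hA hY,
    add_apply, ContinuousLinearMap.comp_apply,
    ContinuousLinearMap.flip_apply, map_add, map_sub]
  abel

/-- If `N_A = 0` then `N_{P(A)} = 0` for every real polynomial `P`
(established in the proof of Corollary 1.5). -/
theorem nijT_polynomial_eval (d : ℕ)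
    (A : (Fin d → ℝ) → ((Fin d → ℝ) →L[ℝ] (Fin d → ℝ))) (hA : ContDiff ℝ (⊤ : ℕ∞) A)
    (hnij : ∀ X Y : (Fin d → ℝ) → (Fin d → ℝ), ContDiff ℝ (⊤ : ℕ∞) X → ContDiff ℝ (⊤ : ℕ∞) Y →
      ∀ x, nijT A X Y x = 0) :
    ∀ P : Polynomial ℝ,
      ∀ X Y : (Fin d → ℝ) → (Fin d → ℝ), ContDiff ℝ (⊤ : ℕ∞) X → ContDiff ℝ (⊤ : ℕ∞) Y →
        ∀ x, nijT (fun y => Polynomial.aeval (A y) P) X Y x = 0 := by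
  intro P X Y hX hY x
  have hA' : Differentiable ℝ A := hA.differentiable (by simp)
  rw [nijT_eq_torsionAt (differentiable_aeval hA' P x) (hX.differentiable (by simp) x)
    (hY.differentiable (by simp) x)]
  refine torsionAt_aeval_aeval hA' (fun u v => ?_) P P _ _
  rw [← hnij (fun _ => u) (fun _ => v) contDiff_const contDiff_const x,
    nijT_eq_torsionAt (hA' x) (differentiableAt_const u) (differentiableAt_const v)]
end
end

section
/- Let A be a C^∞ field of endomorphisms of ℝ^d and let Γ : ℝ^d → (ℝ^d →ₗ[ℝ] ℝ^d →ₗ[ℝ] ℝ^d) be a C^∞ field of symmetric bilinear maps (Γ(x)(u)(v) = Γ(x)(v)(u) for all x, u, v). Assume A is parallel for the associated torsion-free connection: (fderiv A x)(u)(v) + Γ(x)(u)(A(x)(v)) − A(x)(Γ(x)(u)(v)) = 0 for all x, u, v. Then for every p ∈ ℕ the distribution x ↦ ker(A(x)^p) is involutive: for all C^∞ vector fields X, Y with A(x)^p(X(x)) = 0 and A(x)^p(Y(x)) = 0 for all x, one has A(x)^p([X,Y](x)) = 0 for all x. -/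
open scoped BigOperators

noncomputable section

/-- Powers of a parallel field of endomorphisms commute with the covariant derivative
`fderiv ℝ Z x u + Γ x u (Z x)`. -/
theorem pow_apply_covariantDeriv {E : Type*} [NormedAddCommGroup E] [NormedSpace ℝ E]
    {A : E → E →L[ℝ] E} {Γ : E → E →L[ℝ] E →L[ℝ] E} (hA : Differentiable ℝ A)
    (hpar : ∀ x u v, fderiv ℝ A x u v + Γ x u (A x v) - A x (Γ x u v) = 0)
    (p : ℕ) {Z : E → E} (hZ : Differentiable ℝ Z) (x u : E) :
    (A x ^ p) (fderiv ℝ Z x u + Γ x u (Z x)) =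
      fderiv ℝ (fun y => (A y ^ p) (Z y)) x u + Γ x u ((A x ^ p) (Z x)) := by
  induction p generalizing Z with
  | zero => simp
  | succ p ih =>
    have hAZ : A x (fderiv ℝ Z x u + Γ x u (Z x)) =
        fderiv ℝ (fun y => A y (Z y)) x u + Γ x u (A x (Z x)) := by
      rw [fderiv_clm_apply (hA x) (hZ x), map_add, ← sub_eq_zero, ← neg_eq_zero,
        ← hpar x u (Z x)]
      simp only [add_apply, ContinuousLinearMap.comp_apply, ContinuousLinearMap.flip_apply]
      abel
    simp only [pow_succ, mul_apply_eq_comp]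
    rw [hAZ]
    exact ih (hA.clm_apply hZ)

/-- Remark 3.12: if `A` is parallel for a torsion-free affine connection (given by a
smooth symmetric Christoffel field `Γ`), then each kernel distribution `ker A^p`
is involutive. -/
theorem ker_involutive_of_parallel (d : ℕ)
    (A : (Fin d → ℝ) → ((Fin d → ℝ) →L[ℝ] (Fin d → ℝ))) (hA : ContDiff ℝ (⊤ : ℕ∞) A)
    (Γ : (Fin d → ℝ) → ((Fin d → ℝ) →L[ℝ] (Fin d → ℝ) →L[ℝ] (Fin d → ℝ)))
    (hΓ : ContDiff ℝ (⊤ : ℕ∞) Γ)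
    (hsym : ∀ x u v, Γ x u v = Γ x v u)
    (hpar : ∀ x u v, fderiv ℝ A x u v + Γ x u (A x v) - A x (Γ x u v) = 0) :
    ∀ p : ℕ, ∀ X Y : (Fin d → ℝ) → (Fin d → ℝ), ContDiff ℝ (⊤ : ℕ∞) X → ContDiff ℝ (⊤ : ℕ∞) Y →
      (∀ x, (A x ^ p) (X x) = 0) → (∀ x, (A x ^ p) (Y x) = 0) →
      ∀ x, (A x ^ p) (lieVF X Y x) = 0 := by
  intro p X Y hX hY hAX hAY x
  have key : ∀ Z : (Fin d → ℝ) → (Fin d → ℝ), ContDiff ℝ (⊤ : ℕ∞) Z →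
      (∀ y, (A y ^ p) (Z y) = 0) → ∀ u, (A x ^ p) (fderiv ℝ Z x u + Γ x u (Z x)) = 0 := by
    intro Z hZ hAZ u
    rw [pow_apply_covariantDeriv (hA.differentiable (by simp)) hpar p
      (hZ.differentiable (by simp))]
    simp [hAZ]
  have torsion_free : lieVF X Y x =
      (fderiv ℝ Y x (X x) + Γ x (X x) (Y x)) - (fderiv ℝ X x (Y x) + Γ x (Y x) (X x)) := by
    rw [hsym x (Y x) (X x), add_sub_add_right_eq_sub, lieVF]
  rw [torsion_free, map_sub, key Y hY hAY, key X hX hAX, sub_zero]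
end
end

section
/- On ℝ^4 with standard basis e₁, e₂, e₃, e₄ and coordinates (x₁,x₂,x₃,x₄), define the C^∞ field of endomorphisms A by A(x)(e₁) = A(x)(e₂) = 0, A(x)(e₃) = exp(x₂)·e₁ and A(x)(e₄) = e₁. Then: (1) the Nijenhuis tensor of A vanishes identically, N_A(X,Y)(x) = 0 for all C^∞ vector fields X, Y and all x; (2) the distribution ker A is not involutive: the C^∞ vector fields X(x) = e₂ and Y(x) = e₃ − exp(x₂)·e₄ satisfy A(x)(X(x)) = 0 and A(x)(Y(x)) = 0 for all x, yet A(x)([X,Y](x)) = −exp(x₂)·e₁ ≠ 0 for all x. -/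
open scoped BigOperators

noncomputable section

/-- The values of `A` on the standard basis determine `A`. -/
theorem apply_eq_smul_of_apply_basis
    {A : (Fin 4 → ℝ) → ((Fin 4 → ℝ) →L[ℝ] (Fin 4 → ℝ))}
    (h1 : ∀ x : Fin 4 → ℝ, A x (Pi.single 0 1) = 0)
    (h2 : ∀ x : Fin 4 → ℝ, A x (Pi.single 1 1) = 0)
    (h3 : ∀ x : Fin 4 → ℝ, A x (Pi.single 2 1) = Real.exp (x 1) • (Pi.single 0 1 : Fin 4 → ℝ))
    (h4 : ∀ x : Fin 4 → ℝ, A x (Pi.single 3 1) = Pi.single 0 1) (x v : Fin 4 → ℝ) :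
    A x v = (Real.exp (x 1) * v 2 + v 3) • (Pi.single 0 1 : Fin 4 → ℝ) := by
  have hv : v = ∑ i, v i • (Pi.single i 1 : Fin 4 → ℝ) := by
    simpa [← Pi.single_smul] using (Finset.univ_sum_single v).symm
  conv_lhs => rw [hv]
  simp only [Fin.sum_univ_four, map_add, map_smul, h1, h2, h3, h4]
  module

theorem hasFDerivAt_expForm_smul {X : (Fin 4 → ℝ) → (Fin 4 → ℝ)}
    {X' : (Fin 4 → ℝ) →L[ℝ] (Fin 4 → ℝ)} {x : Fin 4 → ℝ} (hX : HasFDerivAt X X' x) :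
    HasFDerivAt
      (fun y => (Real.exp (y 1) * X y 2 + X y 3) • (Pi.single 0 1 : Fin 4 → ℝ))
      ((Real.exp (x 1) • (ContinuousLinearMap.proj (R := ℝ) 2).comp X' +
        X x 2 • Real.exp (x 1) • ContinuousLinearMap.proj (R := ℝ) 1 +
        (ContinuousLinearMap.proj (R := ℝ) 3).comp X').smulRight (Pi.single 0 1 : Fin 4 → ℝ)) x :=
  (((hasFDerivAt_apply (𝕜 := ℝ) (1 : Fin 4) x).exp.mul (hasFDerivAt_pi'.1 hX 2)).add
    (hasFDerivAt_pi'.1 hX 3)).smul_const _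

/-- Example 3.7: the field `A` on `ℝ⁴` with `A e₁ = A e₂ = 0`, `A e₃ = exp(x₂) e₁`,
`A e₄ = e₁` has vanishing Nijenhuis tensor, but `ker A` is not involutive:
`X = e₂` and `Y = e₃ - exp(x₂) e₄` lie in `ker A` while `A [X,Y] = -exp(x₂) e₁ ≠ 0`. -/
theorem example_nijT_zero_ker_not_involutive
    (A : (Fin 4 → ℝ) → ((Fin 4 → ℝ) →L[ℝ] (Fin 4 → ℝ))) (hA : ContDiff ℝ (⊤ : ℕ∞) A)
    (h1 : ∀ x : Fin 4 → ℝ, A x (Pi.single 0 1) = 0)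
    (h2 : ∀ x : Fin 4 → ℝ, A x (Pi.single 1 1) = 0)
    (h3 : ∀ x : Fin 4 → ℝ, A x (Pi.single 2 1) = Real.exp (x 1) • (Pi.single 0 1 : Fin 4 → ℝ))
    (h4 : ∀ x : Fin 4 → ℝ, A x (Pi.single 3 1) = Pi.single 0 1) :
    (∀ X Y : (Fin 4 → ℝ) → (Fin 4 → ℝ), ContDiff ℝ (⊤ : ℕ∞) X → ContDiff ℝ (⊤ : ℕ∞) Y →
        ∀ x, nijT A X Y x = 0) ∧
    (∀ x : Fin 4 → ℝ, A x ((fun _ : Fin 4 → ℝ => (Pi.single 1 1 : Fin 4 → ℝ)) x) = 0) ∧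
    (∀ x : Fin 4 → ℝ,
        A x ((fun y : Fin 4 → ℝ =>
          (Pi.single 2 1 : Fin 4 → ℝ) - Real.exp (y 1) • (Pi.single 3 1 : Fin 4 → ℝ)) x) = 0) ∧
    (∀ x : Fin 4 → ℝ,
        A x (lieVF (fun _ => (Pi.single 1 1 : Fin 4 → ℝ))
              (fun y => (Pi.single 2 1 : Fin 4 → ℝ) - Real.exp (y 1) • (Pi.single 3 1 : Fin 4 → ℝ)) x) =
          -(Real.exp (x 1)) • (Pi.single 0 1 : Fin 4 → ℝ)) ∧
    (∀ x : Fin 4 → ℝ, -(Real.exp (x 1)) • (Pi.single 0 1 : Fin 4 → ℝ) ≠ 0) := by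
  have hAx := apply_eq_smul_of_apply_basis h1 h2 h3 h4
  refine ⟨fun X Y hX hY x => ?_, fun x => h2 x, fun x => ?_, fun x => ?_, fun x h => ?_⟩
  · have hX' := (hX.differentiable (by simp) x).hasFDerivAt
    have hY' := (hY.differentiable (by simp) x).hasFDerivAt
    simp only [nijT, lieVF, hAx, (hasFDerivAt_expForm_smul hX').fderiv,
      (hasFDerivAt_expForm_smul hY').fderiv]
    ext i
    fin_cases i <;> simp
    ring
  · simp [hAx]
  · have hY : HasFDerivAt (fun y : Fin 4 → ℝ =>
        (Pi.single 2 1 : Fin 4 → ℝ) - Real.exp (y 1) • (Pi.single 3 1 : Fin 4 → ℝ)) _ x :=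
      ((hasFDerivAt_apply (𝕜 := ℝ) (1 : Fin 4) x).exp.smul_const
        (Pi.single 3 1 : Fin 4 → ℝ)).const_sub _
    simp [lieVF, hAx, hY.fderiv]
  · simpa using congrFun h 0
end
end
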